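/- For every odd integer m ≥ 3 and every integer n ≥ m − 1, the Ramsey number R(K_{1,n}, W_m) equals 3n + 1; that is, every graph Γ on 3n + 1 vertices contains a copy of the star K_{1,n} or its complement contains a copy of W_m, and this fails for some graph on 3n vertices. -/

import Mathlib

open SimpleGraph

/-- `ContainsCopy Γ H` : `Γ` contains a copy of `H`, i.e. `H` is isomorphic to a subgraph
of `Γ`; equivalently, there is an injective graph homomorphism from `H` to `Γ`. -/
def ContainsCopy {α β : Type*} (Γ : SimpleGraph α) (H : SimpleGraph β) : Prop :=
  ∃ f : H →g Γ, Function.Injective f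

/-- The wheel graph `W_m` on `m+1` vertices: the join of a single hub vertex (`none`)
with the cycle `C_m` (on the vertices `some i`). -/
def wheelGraph (m : ℕ) : SimpleGraph (Option (Fin m)) :=
  SimpleGraph.fromRel (fun x y =>
    x = none ∨ ∃ i j : Fin m, x = some i ∧ y = some j ∧ (SimpleGraph.cycleGraph m).Adj i j)

/-- Reversal of the initial segment `[0, j]` of `Fin (M + 1)`. -/
def reversePrefix {M : ℕ} (j : Fin (M + 1)) : Equiv.Perm (Fin (M + 1)) :=
  Function.Involutive.toPerm
    (fun i => if i ≤ j then ⟨j.val - i.val, by omega⟩ else i)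
    (fun i => by ext; grind)

lemma reversePrefix_of_le {M : ℕ} {j i : Fin (M + 1)} (h : i ≤ j) :
    reversePrefix j i = ⟨j.val - i.val, by omega⟩ := by
  exact if_pos h

lemma reversePrefix_of_lt {M : ℕ} {j i : Fin (M + 1)} (h : j < i) :
    reversePrefix j i = i := by
  exact if_neg h.not_ge

open Classical in
lemma card_filter_adj_equiv {V : Type*} (G : SimpleGraph V) {S : Finset V} {N : ℕ}
    (f : Fin N ≃ S) (x : V) :
    (Finset.univ.filter fun j => G.Adj x (f j)).card = (S.filter (G.Adj x)).card := by
  refine Finset.card_bij (fun j _ => (f j : V)) ?_ ?_ ?_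
  · intro j hj
    simpa using hj
  · intro a _ b _ h
    exact f.injective (Subtype.ext h)
  · intro b hb
    rw [Finset.mem_filter] at hb
    exact ⟨f.symm ⟨b, hb.1⟩, by simpa using hb.2, by simp⟩

open Classical in
/-- The positions at which consecutive vertices of a cyclic arrangement are not adjacent. -/
noncomputable def gaps {V : Type*} (G : SimpleGraph V) {S : Finset V} {M : ℕ}
    (f : Fin (M + 1) ≃ S) : Finset (Fin (M + 1)) :=
  Finset.univ.filter fun i => ¬ G.Adj (f i) (f (i + 1))

lemma mem_gaps {V : Type*} {G : SimpleGraph V} {S : Finset V} {M : ℕ}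
    {f : Fin (M + 1) ≃ S} {i : Fin (M + 1)} :
    i ∈ gaps G f ↔ ¬ G.Adj (f i) (f (i + 1)) := by
  simp [gaps]

lemma card_gaps_addRight {V : Type*} (G : SimpleGraph V) {S : Finset V} {M : ℕ}
    (f : Fin (M + 1) ≃ S) (k : Fin (M + 1)) :
    (gaps G ((Equiv.addRight k).trans f)).card = (gaps G f).card := by
  refine Finset.card_equiv (Equiv.addRight k) fun i => ?_
  simp only [mem_gaps, Equiv.trans_apply, Equiv.coe_addRight]
  rw [add_right_comm i 1 k]

lemma exists_card_gaps_lt_of_last {V : Type*} (G : SimpleGraph V) {S : Finset V} {M : ℕ}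
    (f : Fin (M + 1) ≃ S) (hf : Fin.last M ∈ gaps G f) (j : Fin (M + 1))
    (h₁ : G.Adj (f (Fin.last M)) (f j)) (h₂ : G.Adj (f 0) (f (j + 1))) :
    ∃ g : Fin (M + 1) ≃ S, (gaps G g).card < (gaps G f).card := by
  refine ⟨(reversePrefix j).trans f, ?_⟩
  have hj : j < Fin.last M := by
    refine lt_of_le_of_ne (Fin.le_last j) ?_
    rintro rfl
    exact G.loopless.irrefl _ h₁
  refine lt_of_le_of_lt ?_ (Finset.card_erase_lt_of_mem hf)
  refine Finset.card_le_card_of_injOn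
    (fun i => if i < j then ⟨j.val - 1 - i.val, by omega⟩ else i) ?_ ?_
  · intro i hi
    rw [Finset.mem_coe, mem_gaps] at hi
    simp only [Equiv.trans_apply] at hi
    rw [Finset.mem_coe, Finset.mem_erase, mem_gaps]
    rcases lt_trichotomy i j with hij | rfl | hij
    · have hi1 : (i + 1).val = i.val + 1 := Fin.val_add_one_of_lt (hij.trans hj)
      have hle : i + 1 ≤ j := by
        rw [Fin.le_def]; omega
      rw [reversePrefix_of_le hij.le, reversePrefix_of_le hle] at hi
      simp only [hij, if_true]
      have hlt : (⟨j.val - 1 - i.val, by omega⟩ : Fin (M + 1)) < Fin.last M := by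
        rw [Fin.lt_def] at *; simp at *; omega
      refine ⟨hlt.ne, fun h => hi ?_⟩
      have e : (⟨j.val - 1 - i.val, by omega⟩ : Fin (M + 1)) + 1 =
          ⟨j.val - i.val, by omega⟩ := by
        ext
        rw [Fin.val_add_one_of_lt hlt]
        rw [Fin.lt_def] at *
        simp only
        omega
      rw [e] at h
      convert h.symm using 4
      omega
    · have hi1 : (i + 1).val = i.val + 1 := Fin.val_add_one_of_lt hj
      have hlt : i < i + 1 := by
        rw [Fin.lt_def]; omega
      rw [reversePrefix_of_le le_rfl, reversePrefix_of_lt hlt] at hi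
      refine absurd ?_ hi
      convert h₂ using 4
      simp
    · simp only [hij.not_gt, if_false]
      rcases eq_or_ne i (Fin.last M) with rfl | hne
      · rw [reversePrefix_of_lt hij, Fin.last_add_one,
          reversePrefix_of_le (Fin.zero_le j)] at hi
        exact absurd h₁ hi
      · have hi1 : (i + 1).val = i.val + 1 :=
          Fin.val_add_one_of_lt (lt_of_le_of_ne (Fin.le_last i) hne)
        have hlt : j < i + 1 := by
          rw [Fin.lt_def] at *; omega
        rw [reversePrefix_of_lt hij, reversePrefix_of_lt hlt] at hi
        exact ⟨hne, hi⟩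
  · intro a _ b _ h
    ext
    grind

open Classical in
lemma exists_card_gaps_lt {V : Type*} (G : SimpleGraph V) {S : Finset V} {M : ℕ}
    (hdeg : ∀ v ∈ S, M + 1 ≤ 2 * (S.filter (G.Adj v)).card)
    (f : Fin (M + 1) ≃ S) (hf : (gaps G f).Nonempty) :
    ∃ g : Fin (M + 1) ≃ S, (gaps G g).card < (gaps G f).card := by
  obtain ⟨i, hi⟩ := hf
  rw [← card_gaps_addRight G f (i + 1)]
  set f' := (Equiv.addRight (i + 1)).trans f with hf'
  have hlast : Fin.last M ∈ gaps G f' := by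
    have e : Fin.last M + (i + 1) = i := by
      rw [add_comm i 1, ← add_assoc, Fin.last_add_one, zero_add]
    rw [mem_gaps] at hi ⊢
    rw [Fin.last_add_one]
    simp only [hf', Equiv.trans_apply, Equiv.coe_addRight, e, zero_add]
    exact hi
  set A := Finset.univ.filter fun j => G.Adj (f' (Fin.last M)) (f' j) with hA
  set B := Finset.univ.filter fun j => G.Adj (f' 0) (f' (j + 1)) with hB
  have cA : M + 1 ≤ 2 * A.card := by
    rw [hA, card_filter_adj_equiv]
    exact hdeg _ (f' _).2
  have cB : M + 1 ≤ 2 * B.card := by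
    have : B.card = _ := card_filter_adj_equiv G ((Equiv.addRight 1).trans f') (f' 0)
    rw [this]
    exact hdeg _ (f' _).2
  have hU : (A ∪ B).card < M + 1 := by
    have : A ∪ B ⊆ Finset.univ.erase (Fin.last M) := by
      intro j hj
      refine Finset.mem_erase.2 ⟨?_, Finset.mem_univ _⟩
      rintro rfl
      simp [hA, hB] at hj
    have := Finset.card_le_card this
    rw [Finset.card_erase_of_mem (Finset.mem_univ _)] at this
    simp at this
    omega
  have hI := Finset.card_union_add_card_inter A B
  have : (A ∩ B).Nonempty := Finset.card_pos.1 (by omega)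
  obtain ⟨j, hj⟩ := this
  simp only [hA, hB, Finset.mem_inter, Finset.mem_filter, Finset.mem_univ, true_and] at hj
  exact exists_card_gaps_lt_of_last G f' hlast j hj.1 hj.2

open Classical in
/-- **Dirac's theorem** for the subgraph induced on a finset `S`. -/
lemma exists_hamiltonian_arrangement {V : Type*} (G : SimpleGraph V) {S : Finset V} {M : ℕ}
    (hS : S.card = M + 1) (hdeg : ∀ v ∈ S, M + 1 ≤ 2 * (S.filter (G.Adj v)).card) :
    ∃ f : Fin (M + 1) ≃ S, ∀ i, G.Adj (f i) (f (i + 1)) := by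
  have : Nonempty (Fin (M + 1) ≃ S) := ⟨(S.equivFinOfCardEq hS).symm⟩
  let f : Fin (M + 1) ≃ S := Function.argmin fun f : Fin (M + 1) ≃ S => (gaps G f).card
  refine ⟨f, fun i => ?_⟩
  by_contra hi
  obtain ⟨g, hg⟩ := exists_card_gaps_lt G hdeg f ⟨i, mem_gaps.2 hi⟩
  exact Function.not_lt_argmin (fun f : Fin (M + 1) ≃ S => (gaps G f).card) g hg

open Classical in
/-- If every vertex of `S` is adjacent to more than half of `S`, then `S` spans cycles of
all lengths. -/
lemma exists_cycle_of_dirac {V : Type*} (G : SimpleGraph V) {S : Finset V} {M l : ℕ}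
    (hS : S.card = M + 2) (hdeg : ∀ v ∈ S, M + 3 ≤ 2 * (S.filter (G.Adj v)).card)
    (hl : l ≤ M) :
    ∃ c : Fin (l + 2) → V, Function.Injective c ∧ (∀ i, c i ∈ S) ∧
      ∀ i, G.Adj (c i) (c (i + 1)) := by
  obtain ⟨u, hu⟩ : S.Nonempty := Finset.card_pos.1 (by omega)
  have hfilter (v : V) :
      (S.filter (G.Adj v)).card ≤ ((S.erase u).filter (G.Adj v)).card + 1 := by
    rw [Finset.filter_erase]
    have := Finset.pred_card_le_card_erase (s := S.filter (G.Adj v)) (a := u)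
    omega
  have hcard : (S.erase u).card = M + 1 := by
    rw [Finset.card_erase_of_mem hu]; omega
  obtain ⟨f, hf⟩ := exists_hamiltonian_arrangement G hcard fun v hv => by
    have := hdeg v (Finset.mem_of_mem_erase hv)
    have := hfilter v
    omega
  have hu' : (S.erase u).filter (G.Adj u) = S.filter (G.Adj u) := by
    rw [Finset.filter_erase, Finset.erase_eq_of_notMem (by simp)]
  set A := Finset.univ.filter fun j => G.Adj u (f j) with hA
  set B := Finset.univ.filter fun j => G.Adj u (f (j + Fin.ofNat (M + 1) l)) with hB
  have cA : M + 3 ≤ 2 * A.card := by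
    rw [hA, card_filter_adj_equiv, hu']
    exact hdeg u hu
  have cB : M + 3 ≤ 2 * B.card := by
    have : B.card = _ :=
      card_filter_adj_equiv G ((Equiv.addRight (Fin.ofNat (M + 1) l)).trans f) u
    rw [this, hu']
    exact hdeg u hu
  have hU : (A ∪ B).card ≤ M + 1 := by
    simpa using Finset.card_le_univ (A ∪ B)
  have hI := Finset.card_union_add_card_inter A B
  obtain ⟨j, hj⟩ : (A ∩ B).Nonempty := Finset.card_pos.1 (by omega)
  simp only [hA, hB, Finset.mem_inter, Finset.mem_filter, Finset.mem_univ, true_and] at hj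
  have hne (i : Fin (M + 1)) : (f i : V) ≠ u := Finset.ne_of_mem_erase (f i).2
  refine ⟨Fin.cases u fun t => f (j + Fin.ofNat (M + 1) t), ?_, ?_, ?_⟩
  · intro a b
    induction a using Fin.cases with
    | zero =>
      induction b using Fin.cases with
      | zero => simp
      | succ b => intro h; exact absurd h.symm (hne _)
    | succ a =>
      induction b using Fin.cases with
      | zero => intro h; exact absurd h (hne _)
      | succ b =>
        intro h
        have h' := add_left_cancel (f.injective (Subtype.ext h))
        rw [Fin.ext_iff, Fin.val_ofNat, Fin.val_ofNat, Nat.mod_eq_of_lt (by omega),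
          Nat.mod_eq_of_lt (by omega)] at h'
        exact congrArg Fin.succ (Fin.ext h')
  · intro a
    induction a using Fin.cases with
    | zero => exact hu
    | succ a => exact Finset.mem_of_mem_erase (f _).2
  · intro a
    induction a using Fin.lastCases with
    | last =>
      rw [Fin.last_add_one, ← Fin.succ_last]
      exact hj.2.symm
    | cast a =>
      rw [Fin.coeSucc_eq_succ]
      induction a using Fin.cases with
      | zero =>
        have e : j + Fin.ofNat (M + 1) 0 = j := add_zero j
        change G.Adj u (f (j + Fin.ofNat (M + 1) 0))
        rw [e]
        exact hj.1
      | succ a =>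
        have h := hf (j + Fin.ofNat (M + 1) a)
        rw [add_assoc] at h
        have e : Fin.ofNat (M + 1) a.val + 1 = Fin.ofNat (M + 1) (a.val + 1) := by
          ext; simp [Fin.val_add]
        rw [e] at h
        rw [Fin.castSucc_succ]
        exact h

lemma containsCopy_wheelGraph {V : Type*} (G : SimpleGraph V) {l : ℕ} (v : V)
    (c : Fin (l + 2) → V) (hc : Function.Injective c) (hv : ∀ i, G.Adj v (c i))
    (hadj : ∀ i, G.Adj (c i) (c (i + 1))) : ContainsCopy G (wheelGraph (l + 2)) := by
  have hcycle (i j : Fin (l + 2)) (h : (cycleGraph (l + 2)).Adj i j) : G.Adj (c i) (c j) := by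
    rw [cycleGraph_adj] at h
    rcases h with h | h
    · rw [sub_eq_iff_eq_add'.1 h]
      exact (hadj j).symm
    · rw [sub_eq_iff_eq_add'.1 h]
      exact hadj i
  refine ⟨⟨fun x => x.elim v c, ?_⟩, ?_⟩
  · intro x y h
    rw [wheelGraph, fromRel_adj] at h
    rcases x with _ | i <;> rcases y with _ | j
    · exact absurd rfl h.1
    · exact hv j
    · exact (hv i).symm
    · obtain ⟨-, h | h⟩ := h
      · obtain h | ⟨i', j', hi, hj, h⟩ := h
        · cases h
        · cases hi; cases hj; exact hcycle _ _ h
      · obtain h | ⟨i', j', hi, hj, h⟩ := h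
        · cases h
        · cases hi; cases hj; exact (hcycle _ _ h).symm
  · intro x y h
    rcases x with _ | i <;> rcases y with _ | j
    · rfl
    · exact absurd h (hv j).ne
    · exact absurd h (hv i).ne'
    · exact congrArg some (hc h)

open Classical in
lemma card_filter_adj_lt {V : Type*} (G : SimpleGraph V) (n : ℕ)
    (h : ¬ ContainsCopy G (completeBipartiteGraph (Fin 1) (Fin n))) (v : V) (S : Finset V) :
    (S.filter (G.Adj v)).card < n := by
  by_contra! hn
  obtain ⟨T, hT, hcard⟩ := Finset.exists_subset_card_eq hn
  let e := (T.equivFinOfCardEq hcard).symm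
  have he (i : Fin n) : G.Adj v (e i) := (Finset.mem_filter.1 (hT (e i).2)).2
  refine h ⟨⟨Sum.elim (fun _ => v) (fun i => e i), ?_⟩, ?_⟩
  · rintro (a | a) (b | b) hab
    · simp at hab
    · exact he b
    · exact (he a).symm
    · simp at hab
  · rintro (a | a) (b | b) hab
    · rw [Subsingleton.elim a b]
    · exact absurd hab (he b).ne
    · exact absurd hab (he a).ne'
    · exact congrArg Sum.inr (e.injective (Subtype.ext hab))

open Classical in
lemma containsCopy_wheelGraph_of_card_le {V : Type*} [Fintype V] (G : SimpleGraph V) {n l : ℕ}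
    (hV : Fintype.card V = 3 * n + 1) (hl : l + 1 ≤ n)
    (hG : ∀ (v : V) (S : Finset V), S.card ≤ (S.filter (G.Adj v)).card + n) :
    ContainsCopy G (wheelGraph (l + 2)) := by
  obtain ⟨v⟩ : Nonempty V := Fintype.card_pos_iff.1 (by omega)
  have hv := hG v Finset.univ
  rw [Finset.card_univ, hV] at hv
  obtain ⟨S, hS, hcard⟩ := Finset.exists_subset_card_eq
    (show 2 * n + 1 ≤ (Finset.univ.filter (G.Adj v)).card by omega)
  obtain ⟨M, hM⟩ : ∃ M, 2 * n = M + 1 := ⟨2 * n - 1, by omega⟩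
  obtain ⟨c, hc, hcS, hadj⟩ := exists_cycle_of_dirac G (S := S) (M := M) (l := l) (by omega)
    (fun w _ => by
      have := hG w S
      omega) (by omega)
  exact containsCopy_wheelGraph G v c hc (fun i => (Finset.mem_filter.1 (hS (hcS i))).2) hadj

open Classical in
lemma card_le_card_filter_compl_adj_add {V : Type*} (G : SimpleGraph V) {n : ℕ} (v : V)
    (S : Finset V) (hG : (S.filter (G.Adj v)).card < n) :
    S.card ≤ (S.filter fun w => Gᶜ.Adj v w).card + n := by
  have hsub : S ⊆ insert v ((S.filter fun w => Gᶜ.Adj v w) ∪ S.filter (G.Adj v)) := by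
    intro x hx
    by_cases h : v = x <;> by_cases h' : G.Adj v x <;>
      simp [compl_adj, hx, h, h', eq_comm]
  have h₁ := Finset.card_le_card hsub
  have h₂ := Finset.card_insert_le v ((S.filter fun w => Gᶜ.Adj v w) ∪ S.filter (G.Adj v))
  have h₃ := Finset.card_union_le (S.filter fun w => Gᶜ.Adj v w) (S.filter (G.Adj v))
  omega

/-- The disjoint union of three cliques on `n` vertices each. -/
def threeCliques (n : ℕ) : SimpleGraph (Fin (3 * n)) :=
  fromRel fun x y => x.val % 3 = y.val % 3

lemma threeCliques_adj {n : ℕ} {x y : Fin (3 * n)} :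
    (threeCliques n).Adj x y ↔ x ≠ y ∧ x.val % 3 = y.val % 3 := by
  rw [threeCliques, fromRel_adj]
  grind

lemma not_containsCopy_threeCliques_star (n : ℕ) :
    ¬ ContainsCopy (threeCliques n) (completeBipartiteGraph (Fin 1) (Fin n)) := by
  rintro ⟨f, hf⟩
  have hadj (i : Fin n) := threeCliques_adj.1 (f.map_adj
    (show (completeBipartiteGraph (Fin 1) (Fin n)).Adj (Sum.inl 0) (Sum.inr i) by simp))
  have hmod (x : Fin 1 ⊕ Fin n) : (f x).val % 3 = (f (Sum.inl 0)).val % 3 := by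
    rcases x with x | i
    · rw [Subsingleton.elim x 0]
    · exact (hadj i).2.symm
  have hinj : Function.Injective
      (fun x => (⟨(f x).val / 3, by omega⟩ : Fin n)) := by
    intro x y h
    have h' : (f x).val / 3 = (f y).val / 3 := congrArg Fin.val h
    have hx := hmod x
    have hy := hmod y
    exact hf (Fin.ext (by omega))
  have := Fintype.card_le_of_injective _ hinj
  simp at this

lemma not_containsCopy_compl_threeCliques_wheelGraph (n m : ℕ) (hm : 3 ≤ m) (hodd : Odd m) :
    ¬ ContainsCopy (threeCliques n)ᶜ (wheelGraph m) := by
  rintro ⟨f, -⟩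
  have hcol {x y : Option (Fin m)} (h : (wheelGraph m).Adj x y) :
      (f x).val % 3 ≠ (f y).val % 3 := by
    have h' := f.map_adj h
    rw [compl_adj, threeCliques_adj] at h'
    tauto
  have hhub (i : Fin m) : (f (some i)).val % 3 ≠ (f none).val % 3 :=
    hcol (by simp [wheelGraph])
  have hrim {i j : Fin m} (h : (cycleGraph m).Adj i j) :
      (f (some i)).val % 3 ≠ (f (some j)).val % 3 := by
    refine hcol ?_
    rw [wheelGraph, fromRel_adj]
    exact ⟨by simpa using h.ne, Or.inl (Or.inr ⟨i, j, rfl, rfl, h⟩)⟩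
  have C : (cycleGraph m).Coloring Bool := Coloring.mk
    (fun i => decide ((f (some i)).val % 3 = ((f none).val + 1) % 3)) fun {i j} h => by
      have h₁ := hhub i
      have h₂ := hhub j
      have h₃ := hrim h
      rw [Ne, decide_eq_decide]
      omega
  have h := C.colorable.chromaticNumber_le
  rw [chromaticNumber_cycleGraph_of_odd m (by omega) hodd] at h
  norm_cast at h

/-- For every odd `m ≥ 3` and every `n ≥ m − 1`, the Ramsey number `R(K_{1,n}, W_m)`
equals `3n + 1`. -/
theorem statement13 (n m : ℕ) (hm : 3 ≤ m) (hmodd : Odd m) (hnm : m - 1 ≤ n) :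
    (∀ Γ : SimpleGraph (Fin (3 * n + 1)),
        ContainsCopy Γ (completeBipartiteGraph (Fin 1) (Fin n)) ∨
        ContainsCopy Γᶜ (wheelGraph m)) ∧
    (∃ Γ : SimpleGraph (Fin (3 * n)),
        ¬ ContainsCopy Γ (completeBipartiteGraph (Fin 1) (Fin n)) ∧
        ¬ ContainsCopy Γᶜ (wheelGraph m)) := by
  refine ⟨fun Γ => or_iff_not_imp_left.2 fun h => ?_, threeCliques n,
    not_containsCopy_threeCliques_star n,
    not_containsCopy_compl_threeCliques_wheelGraph n m hm hmodd⟩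
  obtain ⟨l, rfl⟩ : ∃ l, m = l + 2 := ⟨m - 2, by omega⟩
  refine containsCopy_wheelGraph_of_card_le Γᶜ (n := n) (by simp) (by omega) fun v S => ?_
  convert card_le_card_filter_compl_adj_add Γ v S (card_filter_adj_lt Γ n h v S)
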